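/- If a finite soluble group G admits an automorphism φ of prime order p such that |C_G(φ)| = s, then the index of the Fitting subgroup F(G) in G is bounded in terms of p and s only. -/

import Mathlib

theorem aux_index_le {K X : Type*} [Group K] [Finite X] (C : Subgroup K) (g : K → X)
    (hg : ∀ a b, g a = g b → a⁻¹ * b ∈ C) : C.index ≤ Nat.card X := by
  refine Nat.card_le_card_of_injective (fun q : K ⧸ C => g q.out) ?_
  intro a b hab
  have := hg _ _ hab
  rw [← QuotientGroup.eq, QuotientGroup.out_eq', QuotientGroup.out_eq'] at this
  exact this

theorem aux_relIndex_le {K X : Type*} [Group K] [Finite X] (C D : Subgroup K) (g : D → X)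
    (hg : ∀ a b : D, g a = g b → (a : K)⁻¹ * b ∈ C) : C.relIndex D ≤ Nat.card X :=
  aux_index_le _ g (fun a b h => by
    rw [Subgroup.mem_subgroupOf]; simpa using hg a b h)

theorem aux_card_relIndex {K : Type*} [Group K] (C D : Subgroup K) :
    Nat.card D = Nat.card (C ⊓ D : Subgroup K) * C.relIndex D := by
  rw [← Subgroup.inf_relIndex_right, ← Subgroup.relIndex_bot_left, ← Subgroup.relIndex_bot_left]
  exact (Subgroup.relIndex_mul_relIndex _ _ _ bot_le inf_le_right).symm

theorem aux_fix_card_map {H H' : Type*} [Group H] [Group H'] [Finite H] (θ : H →* H')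
    (B : Subgroup H) (f : H) (hf : ∀ b ∈ B, f * b * f⁻¹ ∈ B) :
    Nat.card (B.map θ ⊓ Subgroup.centralizer {θ f} : Subgroup H') ≤
      Nat.card (B ⊓ Subgroup.centralizer {f} : Subgroup H) := by
  set C := B ⊓ Subgroup.centralizer {f} with hC
  set K := B ⊓ (Subgroup.centralizer {θ f}).comap θ with hK
  set L := K ⊓ θ.ker with hL
  have h1 : C.relIndex K ≤ Nat.card L := by
    refine aux_relIndex_le C K (fun k => ⟨k * f * (k : H)⁻¹ * f⁻¹, ?_⟩) ?_
    · obtain ⟨k, hkB, hk⟩ := k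
      have e : k * f * k⁻¹ * f⁻¹ ∈ B := by
        have := B.mul_mem hkB (hf _ (B.inv_mem hkB))
        simpa [mul_assoc] using this
      have e2 : k * f * k⁻¹ * f⁻¹ ∈ θ.ker := by
        rw [MonoidHom.mem_ker]
        have hk' : θ f * θ k = θ k * θ f := by
          simpa [Subgroup.mem_centralizer_iff] using hk
        simp [← hk']
      refine ⟨⟨e, ?_⟩, e2⟩
      change θ (k * f * k⁻¹ * f⁻¹) ∈ Subgroup.centralizer {θ f}
      rw [MonoidHom.mem_ker.1 e2]; exact one_mem _
    · rintro ⟨a, ha⟩ ⟨b, hb⟩ h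
      simp only [Subtype.mk.injEq, mul_left_inj] at h
      refine ⟨B.mul_mem (B.inv_mem ha.1) hb.1, ?_⟩
      change _ ∈ Subgroup.centralizer {f}
      rw [Subgroup.mem_centralizer_singleton_iff]
      calc a⁻¹ * b * f = a⁻¹ * (b * f * b⁻¹) * b := by group
        _ = _ := by rw [← h]; group
  have h2 : Nat.card K = Nat.card L * Nat.card (K.map θ) := by
    rw [aux_card_relIndex θ.ker K, Subgroup.relIndex_ker, inf_comm]
  have h3 : B.map θ ⊓ Subgroup.centralizer {θ f} ≤ K.map θ := by
    rintro _ ⟨⟨b, hb, rfl⟩, h⟩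
    exact ⟨b, ⟨hb, h⟩, rfl⟩
  have h4 := aux_card_relIndex C K
  have : Finite (K.map θ) := Finite.Set.finite_image (K : Set H) θ
  have h5 : Nat.card (B.map θ ⊓ Subgroup.centralizer {θ f} : Subgroup H') ≤ Nat.card (K.map θ) :=
    Subgroup.card_le_of_le h3
  have h6 : 0 < Nat.card L := Nat.card_pos
  refine h5.trans ?_
  have h7 : Nat.card L * Nat.card (K.map θ) ≤ Nat.card L * Nat.card C := by
    have h8 : Nat.card (C ⊓ K : Subgroup H) ≤ Nat.card C := Subgroup.card_le_of_le inf_le_left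
    rw [← h2, h4, mul_comm]; gcongr
  exact Nat.le_of_mul_le_mul_left h7 h6

theorem aux_card_fiber {X Y : Type*} [Finite X] [Finite Y] (g : X → Y) (p : ℕ)
    (h : ∀ x0, ∃ k : Fin p → X, ∀ x, g x = g x0 → ∃ i, k i = x) :
    Nat.card X ≤ p * Nat.card Y := by
  classical
  have := Fintype.ofFinite X
  have := Fintype.ofFinite Y
  rw [Nat.card_eq_fintype_card, Nat.card_eq_fintype_card, mul_comm]
  have := Finset.card_le_mul_card_image_of_maps_to (f := g) (s := Finset.univ) (t := Finset.univ)
    (fun _ _ => Finset.mem_univ _) p ?_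
  · simpa [mul_comm] using this
  · intro y _
    by_cases hy : ∃ x0, g x0 = y
    · obtain ⟨x0, rfl⟩ := hy
      obtain ⟨k, hk⟩ := h x0
      calc _ ≤ (Finset.univ.image k).card := Finset.card_le_card (by
            intro x hx
            simpa using hk x (by simpa using hx))
        _ ≤ p := by simpa using Finset.card_image_le (s := (Finset.univ : Finset (Fin p))) (f := k)
    · rw [Finset.card_eq_zero.2]
      · exact Nat.zero_le _
      · ext x; simp; intro hx; exact hy ⟨x, hx⟩

open Polynomial in
theorem aux_ring {S : Type*} [CommRing S] [Finite S] (σ : S ≃+* S) (p : ℕ) (hp : 0 < p)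
    (hσ : ∀ x, σ^[p] x = x) (t : ℕ) (ht : Nat.card {x : S // σ x = x} ≤ t) (k : ℕ)
    (hk : IsUnit (k : S)) (U : Subgroup Sˣ) (hU : ∀ u ∈ U, u ^ k = 1) :
    Nat.card U ≤ (p * t ^ (p + 1)) ^ (p * 2 ^ t) := by
  classical
  have ht1 : 0 < t := by
    have : Nonempty {x : S // σ x = x} := ⟨⟨0, map_zero σ⟩⟩
    exact lt_of_lt_of_le Nat.card_pos ht
  let P : S → S[X] := fun x => ∏ i ∈ Finset.range p, (X - C (σ^[i] x))
  have hPσ : ∀ x, (P x).map (σ : S →+* S) = P x := by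
    intro x
    simp only [P, Polynomial.map_prod, Polynomial.map_sub, map_X, map_C]
    have e : ∀ i, X - C ((σ : S →+* S) (σ^[i] x)) = X - C (σ^[i + 1] x) := by
      intro i; rw [Function.iterate_succ_apply']; rfl
    simp_rw [e]
    have h1 := Finset.prod_range_succ (fun i => X - C (σ^[i] x)) p
    have h2 := Finset.prod_range_succ' (fun i => X - C (σ^[i] x)) p
    rw [h1, hσ] at h2
    simp only [Function.iterate_zero, id_eq] at h2
    exact ((monic_X_sub_C x).isRegular.right h2).symm
  have hPx : ∀ x, (P x).eval x = 0 := by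
    intro x
    simp only [P, eval_prod]
    exact Finset.prod_eq_zero (Finset.mem_range.2 hp) (by simp)
  have hdeg : ∀ x, (P x).natDegree ≤ p := by
    intro x
    refine (natDegree_prod_le _ _).trans ?_
    refine (Finset.sum_le_card_nsmul _ _ 1 ?_).trans (by simp)
    intro i _
    exact natDegree_X_sub_C_le _
  let A := {x : S // σ x = x}
  have hfield : ∀ m : Ideal S, m.IsMaximal → Nat.card (S ⧸ m) ≤ p * t ^ (p + 1) := by
    intro m hm
    have hfin : Finite (S ⧸ m) := Quotient.finite _
    let g : S ⧸ m → (Fin (p + 1) → A) := fun x j => ⟨(P x.out).coeff j, by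
      conv_rhs => rw [← hPσ]
      rw [coeff_map]; rfl⟩
    have := aux_card_fiber g p ?_
    · refine this.trans ?_
      gcongr
      rw [Nat.card_fun]; simp
      gcongr
    · intro x0
      refine ⟨fun i => Ideal.Quotient.mk m (σ^[i] x0.out), fun x hx => ?_⟩
      have hPP : P x.out = P x0.out := by
        ext j
        by_cases hj : j < p + 1
        · have := congrFun hx ⟨j, hj⟩
          exact congrArg Subtype.val this
        · rw [coeff_eq_zero_of_natDegree_lt, coeff_eq_zero_of_natDegree_lt]
          · have := hdeg x0.out; omega
          · have := hdeg x.out; omega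
      have h0 := hPx x.out
      rw [hPP] at h0
      simp only [P, eval_prod, eval_sub, eval_X, eval_C] at h0
      have h1 : ∏ i ∈ Finset.range p, (x.out - σ^[i] x0.out) ∈ m := by rw [h0]; exact m.zero_mem
      rw [hm.isPrime.prod_mem_iff] at h1
      obtain ⟨i, hi, him⟩ := h1
      refine ⟨⟨i, Finset.mem_range.1 hi⟩, ?_⟩
      have : Ideal.Quotient.mk m x.out = x := Quotient.out_eq' x
      rw [← this, eq_comm]
      exact Ideal.Quotient.eq.2 him
  have hfinmax : Finite (MaximalSpectrum S) := inferInstance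
  have hA : ∀ x : S, σ (∏ i ∈ Finset.range p, σ^[i] x) = ∏ i ∈ Finset.range p, σ^[i] x := by
    intro x
    rw [map_prod]
    obtain ⟨q, rfl⟩ : ∃ q, p = q + 1 := ⟨p - 1, by omega⟩
    rw [Finset.prod_range_succ, Finset.prod_range_succ']
    congr 1
    · exact Finset.prod_congr rfl fun i _ => by rw [Function.iterate_succ_apply']
    · rw [← Function.iterate_succ_apply' σ, hσ]; rfl
  have hmax : Nat.card (MaximalSpectrum S) ≤ p * 2 ^ t := by
    let g : MaximalSpectrum S → Set A := fun m => {a | (a : S) ∈ m.asIdeal}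
    have := aux_card_fiber g p ?_
    · refine this.trans ?_
      gcongr
      have : Nat.card (Set A) = 2 ^ Nat.card A := by
        have := Fintype.ofFinite A
        simp
      rw [this]; gcongr; norm_num
    · intro m0
      let k' : ℕ → Ideal S := fun i => m0.asIdeal.comap ((σ : S →+* S) ^ i)
      have hpow : ∀ i x, ((σ : S →+* S) ^ i) x = σ^[i] x := fun i x => by
        rw [RingHom.coe_pow]; rfl
      have hk' : ∀ i, (k' i).IsMaximal := fun i => by
        have := m0.isMaximal
        refine Ideal.comap_isMaximal_of_surjective _ ?_
        rw [RingHom.coe_pow]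
        exact σ.surjective.iterate i
      refine ⟨fun i => ⟨k' i, hk' i⟩, fun m hm => ?_⟩
      have hsub : (m.asIdeal : Set S) ⊆ ⋃ i ∈ (Finset.range p : Set ℕ), (k' i : Set S) := by
        intro x hx
        have h1 : (⟨_, hA x⟩ : A) ∈ g m := by
          change ∏ i ∈ Finset.range p, σ^[i] x ∈ m.asIdeal
          refine Ideal.prod_mem _ (Finset.mem_range.2 hp) ?_
          simpa using hx
        rw [hm] at h1
        change ∏ i ∈ Finset.range p, σ^[i] x ∈ m0.asIdeal at h1
        rw [m0.isMaximal.isPrime.prod_mem_iff] at h1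
        obtain ⟨i, hi, h⟩ := h1
        refine Set.mem_iUnion₂.2 ⟨i, by simpa using hi, ?_⟩
        change ((σ : S →+* S) ^ i) x ∈ m0.asIdeal
        rwa [hpow]
      rw [Ideal.subset_union_prime 0 0 (fun i _ _ _ => (hk' i).isPrime)] at hsub
      obtain ⟨i, hi, hle⟩ := hsub
      refine ⟨⟨i, Finset.mem_range.1 hi⟩, ?_⟩
      ext1
      exact (m.isMaximal.eq_of_le (hk' i).ne_top hle).symm
  have hinj : Function.Injective
      (fun (u : U) (m : MaximalSpectrum S) => Ideal.Quotient.mk m.asIdeal ((u : Sˣ) : S)) := by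
    intro u v huv
    let w : Sˣ := (u : Sˣ) * (v : Sˣ)⁻¹
    have hw : w ^ k = 1 := hU _ (U.mul_mem u.2 (U.inv_mem v.2))
    have hwm : ∀ m : Ideal S, m.IsMaximal → Ideal.Quotient.mk m (w : S) = 1 := by
      intro m hm
      have := congrFun huv ⟨m, hm⟩
      simp only at this
      simp only [w, Units.val_mul, map_mul, this]
      rw [← map_mul]; simp
    have hun : IsUnit (∑ i ∈ Finset.range k, (w : S) ^ i) := by
      by_contra hcon
      obtain ⟨m, hm, hmem⟩ := exists_max_ideal_of_mem_nonunits hcon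
      rw [← Ideal.Quotient.eq_zero_iff_mem] at hmem
      simp only [map_sum, map_pow, hwm m hm, one_pow, Finset.sum_const, Finset.card_range,
        nsmul_eq_mul, mul_one] at hmem
      have h2 := hk.map (Ideal.Quotient.mk m)
      rw [map_natCast, hmem] at h2
      have := hm
      exact not_isUnit_zero h2
    have h3 : (∑ i ∈ Finset.range k, (w : S) ^ i) * ((w : S) - 1) = 0 := by
      rw [geom_sum_mul, ← Units.val_pow_eq_pow_val, hw]; simp
    have h4 := (hun.mul_right_eq_zero).1 h3
    have h5 : w = 1 := by ext; simpa [sub_eq_zero] using h4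
    ext1
    exact mul_inv_eq_one.1 h5
  have hfq : ∀ m : MaximalSpectrum S, Finite (S ⧸ m.asIdeal) := fun m => Quotient.finite _
  have := Nat.card_le_card_of_injective _ hinj
  refine this.trans ?_
  have := Fintype.ofFinite (MaximalSpectrum S)
  rw [Nat.card_pi]
  refine (Finset.prod_le_pow_card _ _ (p * t ^ (p + 1)) (fun m _ => hfield _ m.isMaximal)).trans ?_
  refine Nat.pow_le_pow_right (by positivity) ?_
  simpa using hmax

theorem aux_cyc_index {M B : Type*} [AddCommGroup M] [Finite M] [CommGroup B] [Finite B]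
    (ρ : B →* AddMonoid.End M) (F : M ≃+ M) (e : B ≃* B) (p : ℕ) (hp : 0 < p)
    (hF : ∀ b m, F (ρ b m) = ρ (e b) (F m)) (hep : ∀ b, e^[p] b = b)
    (hcop : (Nat.card B).Coprime (Nat.card M)) (s : ℕ)
    (hs1 : Nat.card {m : M // F m = m} ≤ s) (T : Subgroup B)
    (hT : ∀ b, (∀ c, F c = c → ρ b c = c) → b ∈ T) :
    T.index ≤ (p * (s ^ s) ^ (p + 1)) ^ (p * 2 ^ (s ^ s)) := by
  classical
  let C := {m : M // F m = m}
  let R := MonoidAlgebra ℤ B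
  let L : R →ₐ[ℤ] AddMonoid.End M := MonoidAlgebra.lift ℤ (AddMonoid.End M) B ρ
  let σ0 : R ≃ₐ[ℤ] R := MonoidAlgebra.domCongr ℤ ℤ e
  have hLof : ∀ b, L (MonoidAlgebra.of ℤ B b) = ρ b :=
    fun b => MonoidAlgebra.lift_of ρ b
  have hσof : ∀ b, σ0 (MonoidAlgebra.of ℤ B b) = MonoidAlgebra.of ℤ B (e b) := fun b => by
    change MonoidAlgebra.domCongr ℤ ℤ e (MonoidAlgebra.single b 1) = MonoidAlgebra.single (e b) 1
    rw [MonoidAlgebra.domCongr_single]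
  have hLσ : ∀ (x : R) (m : M), L (σ0 x) (F m) = F (L x m) := by
    intro x
    induction x using MonoidAlgebra.induction_on with
    | of b => intro m; rw [hσof, hLof, hLof, hF]
    | add a b ha hb => 
      intro m
      rw [map_add, map_add, map_add]
      change L (σ0 a) (F m) + L (σ0 b) (F m) = F (L a m + L b m)
      rw [ha, hb, map_add]
    | smul r a ha => 
      intro m
      rw [map_smul, map_smul, map_smul]
      change r • L (σ0 a) (F m) = F (r • L a m)
      rw [ha, map_zsmul]
  let I : Ideal R :=
    { carrier := {x | ∀ c, F c = c → L x c = 0}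
      add_mem' := by
        intro a b ha hb c hc
        rw [map_add]
        change L a c + L b c = 0
        rw [ha c hc, hb c hc, add_zero]
      zero_mem' := by intro c hc; simp
      smul_mem' := by
        intro r x hx c hc
        rw [smul_eq_mul, map_mul]
        change L r (L x c) = 0
        rw [hx c hc, map_zero] }
  have hI : ∀ x, x ∈ I ↔ ∀ c, F c = c → L x c = 0 := fun x => Iff.rfl
  have hIσ : ∀ x, σ0 x ∈ I ↔ x ∈ I := by
    intro x
    rw [hI, hI]
    refine forall_congr' fun c => forall_congr' fun hc => ?_
    have := hLσ x c
    rw [hc] at this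
    rw [this]; simp
  let σ : (R ⧸ I) ≃+* (R ⧸ I) := Ideal.quotientEquiv I I (σ0 : R ≃+* R) (by
    apply le_antisymm
    · intro x hx
      have : x = (σ0 : R ≃+* R) (σ0.symm x) := by simp
      rw [this]
      apply Ideal.mem_map_of_mem (σ0 : R ≃+* R)
      rw [← hIσ]; simpa using hx
    · rw [Ideal.map_le_iff_le_comap]
      intro x hx
      exact (hIσ x).2 hx)
  have hσmk : ∀ x, σ (Ideal.Quotient.mk I x) = Ideal.Quotient.mk I (σ0 x) := fun x => by
    simp [σ]
  have hmkeq : ∀ x y, Ideal.Quotient.mk I x = Ideal.Quotient.mk I y ↔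
      ∀ c, F c = c → L x c = L y c := by
    intro x y
    rw [Ideal.Quotient.eq, hI]
    refine forall_congr' fun c => forall_congr' fun hc => ?_
    rw [map_sub]
    change L x c - L y c = 0 ↔ _
    rw [sub_eq_zero]
  have hout : ∀ x : R ⧸ I, Ideal.Quotient.mk I x.out = x := fun x => Quotient.out_eq' x
  have hfinS : Finite (R ⧸ I) := by
    refine Finite.of_injective (fun (x : R ⧸ I) (c : C) => L x.out c) ?_
    intro x y hxy
    rw [← hout x, ← hout y, hmkeq]
    intro c hc
    exact congrFun hxy ⟨c, hc⟩
  have hfix : Nat.card {x : R ⧸ I // σ x = x} ≤ s ^ s := by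
    have hlem : ∀ x : R ⧸ I, σ x = x → ∀ c, F c = c → F (L x.out c) = L x.out c := by
      intro x hx c hc
      rw [← hout x, hσmk, hmkeq] at hx
      have h1 := hx c hc
      have h2 := hLσ x.out c
      rw [hc] at h2
      rw [← h2, h1]
    have := Nat.card_le_card_of_injective
      (fun (x : {x : R ⧸ I // σ x = x}) (c : C) => (⟨L x.1.out c, hlem x.1 x.2 c c.2⟩ : C)) ?_
    · refine this.trans ?_
      rw [Nat.card_fun]
      have : 0 < Nat.card C := by
        have : Nonempty C := ⟨⟨0, map_zero F⟩⟩
        exact Nat.card_pos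
      calc _ ≤ s ^ Nat.card C := by gcongr
        _ ≤ s ^ s := Nat.pow_le_pow_right (lt_of_lt_of_le this hs1) hs1
    · rintro ⟨x, hx⟩ ⟨y, hy⟩ hxy
      rw [Subtype.mk.injEq, ← hout x, ← hout y, hmkeq]
      intro c hc
      exact congrArg Subtype.val (congrFun hxy ⟨c, hc⟩)
  have hσp : ∀ x, σ^[p] x = x := by
    intro x
    have h1 : ∀ i (b : B), σ0^[i] (MonoidAlgebra.of ℤ B b) = MonoidAlgebra.of ℤ B (e^[i] b) := by
      intro i b
      induction i with
      | zero => rfl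
      | succ i ih => rw [Function.iterate_succ_apply', ih, hσof, Function.iterate_succ_apply']
    have h2 : ∀ y : R, σ0^[p] y = y := by
      intro y
      have h3 : ∀ i y, σ0^[i] y = (σ0 ^ i) y := fun i y => by
        induction i with
        | zero => rfl
        | succ i ih => rw [Function.iterate_succ_apply', ih, pow_succ']; rfl
      rw [h3]
      induction y using MonoidAlgebra.induction_on with
      | of b => rw [← h3, h1, hep]
      | add a b ha hb => rw [map_add, ha, hb]
      | smul r a ha => rw [map_smul, ha]
    have h4 : ∀ i y, σ^[i] (Ideal.Quotient.mk I y) = Ideal.Quotient.mk I (σ0^[i] y) := by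
      intro i y
      induction i with
      | zero => rfl
      | succ i ih => rw [Function.iterate_succ_apply', ih, hσmk, Function.iterate_succ_apply']
    rw [← hout x, h4, h2]
  have hk : IsUnit ((Nat.card B : ℕ) : R ⧸ I) := by
    obtain ⟨a, b, hab⟩ := Nat.isCoprime_iff_coprime.2 hcop
    have h0 : ((Nat.card M : ℕ) : R ⧸ I) = 0 := by
      rw [← map_natCast (Ideal.Quotient.mk I), Ideal.Quotient.eq_zero_iff_mem, hI]
      intro c _
      rw [map_natCast]
      change (Nat.card M) • c = 0
      exact card_nsmul_eq_zero'
    have h1 := congrArg (Int.cast : ℤ → R ⧸ I) hab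
    push_cast at h1
    rw [h0, mul_zero, add_zero] at h1
    exact IsUnit.of_mul_eq_one_right _ h1
  let θ : B →* (R ⧸ I)ˣ :=
    MonoidHom.toHomUnits (((Ideal.Quotient.mk I : R →+* R ⧸ I) : R →* R ⧸ I).comp (MonoidAlgebra.of ℤ B))
  have hθ : ∀ b, ((θ b : (R ⧸ I)ˣ) : R ⧸ I) = Ideal.Quotient.mk I (MonoidAlgebra.of ℤ B b) :=
    fun b => rfl
  have hcard := aux_ring σ p hp hσp (s ^ s) hfix (Nat.card B) hk θ.range (by
    rintro _ ⟨b, rfl⟩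
    rw [← map_pow, pow_card_eq_one', map_one])
  rw [← Subgroup.index_ker] at hcard
  refine le_trans (Nat.le_of_dvd (Nat.pos_of_ne_zero Subgroup.index_ne_zero_of_finite)
    (Subgroup.index_dvd_of_le ?_)) hcard
  intro b hb
  apply hT
  rw [MonoidHom.mem_ker, Units.ext_iff, hθ, Units.val_one, ← map_one (Ideal.Quotient.mk I), hmkeq] at hb
  intro c hc
  have := hb c hc
  rw [hLof, map_one] at this
  exact this

theorem aux_nsmul_mem {M : Type*} [AddCommGroup M] [Finite M] (W : AddSubgroup M) (k : ℕ)
    (hk : k.Coprime (Nat.card M)) (x : M) (hx : k • x ∈ W) : x ∈ W := by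
  obtain ⟨a, b, hab⟩ := Nat.isCoprime_iff_coprime.2 hk
  have : x = a • (k • x) := by
    have h1 : (a * k + b * (Nat.card M : ℤ)) • x = x := by rw [hab, one_smul]
    rw [add_smul, mul_smul, mul_smul, natCast_zsmul, natCast_zsmul, card_nsmul_eq_zero',
      smul_zero, add_zero] at h1
    exact h1.symm
  rw [this]
  exact W.zsmul_mem hx a

/-- The bound for a faithful coprime abelian group action. -/
def auxN0 (p s : ℕ) : ℕ := s ^ (p - 1) * (p * (s ^ s) ^ (p + 1)) ^ (p * 2 ^ (s ^ s))

theorem aux_module {M B : Type*} [AddCommGroup M] [Finite M] [CommGroup B] [Finite B]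
    (ρ : B →* AddMonoid.End M) (hρ : Function.Injective ρ)
    (F : M ≃+ M) (e : B ≃* B) (p : ℕ) (hp : p.Prime)
    (hF : ∀ b m, F (ρ b m) = ρ (e b) (F m)) (hFp : ∀ m, F^[p] m = m) (hep : ∀ b, e^[p] b = b)
    (hcop : (Nat.card B).Coprime (Nat.card M)) (s : ℕ)
    (hs1 : Nat.card {m : M // F m = m} ≤ s) (hs2 : Nat.card {b : B // e b = b} ≤ s) :
    Nat.card B ≤ auxN0 p s := by
  classical
  have := Fintype.ofFinite B
  -- fixed points
  let T2 : Subgroup B :=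
    { carrier := {b | ∀ c, F c = c → ρ b c = c}
      mul_mem' := by
        intro a b ha hb c hc
        rw [map_mul]
        change ρ a (ρ b c) = c
        rw [hb c hc, ha c hc]
      one_mem' := by intro c _; rw [map_one]; rfl
      inv_mem' := by
        intro a ha c hc
        conv_lhs => rw [← ha c hc]
        change (ρ a⁻¹ * ρ a) c = c
        rw [← map_mul, inv_mul_cancel, map_one]; rfl }
  have hT2 : T2.index ≤ _ := aux_cyc_index ρ F e p hp.pos hF hep hcop s hs1 T2 (fun b hb => hb)
  let W : AddSubgroup M := AddSubgroup.closure {x | ∃ b c, F c = c ∧ x = ρ b c}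
  have hmul : ∀ a b m, ρ a (ρ b m) = ρ (a * b) m := fun a b m => by rw [map_mul]; rfl
  have hWinv : ∀ b, ∀ w ∈ W, ρ b w ∈ W := by
    intro b w hw
    induction hw using AddSubgroup.closure_induction with
    | mem x hx =>
      obtain ⟨a, c, hc, rfl⟩ := hx
      exact AddSubgroup.subset_closure ⟨b * a, c, hc, hmul _ _ _⟩
    | zero => rw [map_zero]; exact W.zero_mem
    | add x y _ _ hx hy => rw [map_add]; exact W.add_mem hx hy
    | neg x _ hx => rw [map_neg]; exact W.neg_mem hx
  have hWT2 : ∀ b ∈ T2, ∀ w ∈ W, ρ b w = w := by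
    intro b hb w hw
    induction hw using AddSubgroup.closure_induction with
    | mem x hx =>
      obtain ⟨a, c, hc, rfl⟩ := hx
      rw [hmul, mul_comm, ← hmul, hb c hc]
    | zero => rw [map_zero]
    | add x y _ _ hx hy => rw [map_add, hx, hy]
    | neg x _ hx => rw [map_neg, hx]
  have heip : ∀ i (b : B), e^[i] b = (e ^ i : MulAut B) b := fun i b => by
    induction i with
    | zero => rfl
    | succ i ih => rw [Function.iterate_succ_apply', ih, pow_succ']; rfl
  let β : ℕ → B →* B := fun i =>
    { toFun := fun b => b * (e^[i] b)⁻¹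
      map_one' := by rw [heip]; simp
      map_mul' := by intro a b; simp only [heip, map_mul, mul_inv]; exact mul_mul_mul_comm _ _ _ _ }
  let T1 : Subgroup B := ⨅ i : Fin (p - 1), (β (i + 1)).range
  have hT1 : T1.index ≤ s ^ (p - 1) := by
    refine (Subgroup.index_iInf_le _).trans ?_
    refine (Finset.prod_le_pow_card _ _ s ?_).trans (by simp)
    intro i _
    have h1 := Subgroup.card_mul_index (β (i + 1)).ker
    have h2 := Subgroup.card_mul_index (β (i + 1)).range
    rw [Subgroup.index_ker] at h1
    rw [← h1, mul_comm] at h2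
    have h3 := Nat.eq_of_mul_eq_mul_right Nat.card_pos h2
    rw [h3]
    refine le_trans ?_ hs2
    refine Nat.card_le_card_of_injective
      (fun b : (β (i + 1)).ker => (⟨b.1, ?_⟩ : {b : B // e b = b})) ?_
    · have hb : b.1 * (e^[i + 1] b.1)⁻¹ = 1 := b.2
      have hb' : Function.IsPeriodicPt e (i + 1) b.1 := (mul_inv_eq_one.1 hb).symm
      have hb2 : Function.IsPeriodicPt e p b.1 := hep _
      have := hb2.gcd hb'
      have hg : Nat.gcd p (i + 1) = 1 := by
        have := i.2
        exact Nat.coprime_of_lt_prime (by omega) (by omega) hp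
      rw [hg] at this
      exact this
    · intro a b hab
      exact Subtype.ext (congrArg (fun x : {b : B // e b = b} => x.1) hab)
  have hFi : ∀ i b m, F^[i] (ρ b m) = ρ (e^[i] b) (F^[i] m) := by
    intro i b m
    induction i with
    | zero => rfl
    | succ i ih => rw [Function.iterate_succ_apply', ih, hF, Function.iterate_succ_apply',
        Function.iterate_succ_apply']
  have hN : ∀ m, F (∑ i ∈ Finset.range p, F^[i] m) = ∑ i ∈ Finset.range p, F^[i] m := by
    intro m
    rw [map_sum]
    obtain ⟨q, rfl⟩ : ∃ q, p = q + 1 := ⟨p - 1, by have := hp.pos; omega⟩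
    rw [Finset.sum_range_succ, Finset.sum_range_succ']
    congr 1
    · exact Finset.sum_congr rfl fun i _ => by rw [Function.iterate_succ_apply']
    · rw [← Function.iterate_succ_apply' F, hFp]; rfl
  have hT1W : ∀ t ∈ T1, ∀ m, ρ t m - m ∈ W := by
    intro t ht m
    apply aux_nsmul_mem W _ hcop
    let Y : ℕ → M := fun i => ∑ c : B, ρ (β i c) (F^[i] m)
    have hYW : ∑ i ∈ Finset.range p, Y i ∈ W := by
      have : ∑ i ∈ Finset.range p, Y i =
          ∑ c : B, ρ c (∑ i ∈ Finset.range p, F^[i] (ρ c⁻¹ m)) := by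
        simp only [Y]
        rw [Finset.sum_comm]
        refine Finset.sum_congr rfl fun c _ => ?_
        rw [map_sum]
        refine Finset.sum_congr rfl fun i _ => ?_
        rw [hFi, hmul]
        congr 2
        change c * (e^[i] c)⁻¹ = c * (e^[i] c⁻¹)
        rw [heip, heip, map_inv]
      rw [this]
      refine W.sum_mem fun c _ => AddSubgroup.subset_closure ⟨c, _, hN _, rfl⟩
    have hY0 : Y 0 = Nat.card B • m := by
      have : ∀ c, β 0 c = 1 := fun c => mul_inv_cancel c
      simp only [Y, this, map_one]
      change ∑ c : B, m = _
      simp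
    have hYt : ∀ i < p - 1, ρ t (Y (i + 1)) = Y (i + 1) := by
      intro i hi
      obtain ⟨c', hc'⟩ := (Subgroup.mem_iInf.1 ht) ⟨i, hi⟩
      simp only [Y]
      rw [map_sum]
      refine Fintype.sum_equiv (Equiv.mulLeft c') _ _ fun c => ?_
      have hc2 : β (i + 1) c' = t := hc'
      rw [hmul, Equiv.coe_mulLeft, map_mul (β (i + 1)), hc2]
    have h3 : ∑ i ∈ Finset.range p, Y i = ∑ i ∈ Finset.range (p - 1), Y (i + 1) + Y 0 := by
      obtain ⟨q, rfl⟩ : ∃ q, p = q + 1 := ⟨p - 1, by have := hp.pos; omega⟩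
      rw [Finset.sum_range_succ']; rfl
    have h4 : ρ t (∑ i ∈ Finset.range p, Y i) - ∑ i ∈ Finset.range p, Y i =
        Nat.card B • (ρ t m - m) := by
      rw [h3, map_add, map_sum, Finset.sum_congr rfl
        (fun i hi => hYt i (Finset.mem_range.1 hi)), hY0, map_nsmul, smul_sub]
      abel
    rw [← h4]
    exact W.sub_mem (hWinv _ _ hYW) hYW
  have hbot : T1 ⊓ T2 = ⊥ := by
    rw [eq_bot_iff]
    rintro t ⟨ht1, ht2⟩
    rw [Subgroup.mem_bot]
    apply hρ
    ext m
    rw [map_one]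
    change ρ t m = m
    have hw := hT1W t ht1 m
    have hw2 := hWT2 t ht2 _ hw
    have hk : ∀ k : ℕ, ρ (t ^ k) m = m + k • (ρ t m - m) := by
      intro k
      induction k with
      | zero => rw [pow_zero, map_one, zero_smul, add_zero]; rfl
      | succ k ih =>
        rw [pow_succ', ← hmul, ih, map_add, map_nsmul, hw2, succ_nsmul]
        abel
    have h5 := hk (Nat.card B)
    rw [pow_card_eq_one', map_one] at h5
    change m = _ at h5
    have h6 : Nat.card B • (ρ t m - m) ∈ (⊥ : AddSubgroup M) := by
      rw [AddSubgroup.mem_bot]; simpa using h5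
    have h7 := aux_nsmul_mem ⊥ _ hcop _ h6
    rw [AddSubgroup.mem_bot] at h7
    exact sub_eq_zero.1 h7
  rw [← Subgroup.index_bot, ← hbot]
  refine Subgroup.index_inf_le.trans ?_
  unfold auxN0
  gcongr

/-- The bound for class two groups. -/
def auxN2 (n p : ℕ) : ℕ := (n ^ p + 1) * n * n ^ (n + (n ^ p + 1) * p)

open scoped commutatorElement in
theorem aux_class2 {H : Type*} [Group H] [Finite H] (D : Subgroup H) (f : H)
    (hfD : ∀ d ∈ D, f * d * f⁻¹ ∈ D) (p : ℕ) (hp : 0 < p) (hfp : f ^ p = 1)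
    (hD : ⁅D, D⁆ ≤ Subgroup.centralizer (D : Set H)) (n : ℕ)
    (hn : ∀ B : Subgroup H, B ≤ D → (∀ a ∈ B, ∀ b ∈ B, Commute a b) →
      (∀ b ∈ B, f * b * f⁻¹ ∈ B) → Nat.card B ≤ n) : Nat.card D ≤ auxN2 n p := by
  classical
  by_contra hcon
  rw [not_le] at hcon
  let c : ℕ → H → H := fun i x => f ^ i * x * (f ^ i)⁻¹
  have hc_add : ∀ i j x, c i (c j x) = c (i + j) x := by
    intro i j x; simp only [c, pow_add]; group
  have hc_p : ∀ i x, c (i + p) x = c i x := by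
    intro i x; simp only [c, pow_add, hfp, mul_one]
  have hc_comm : ∀ i x y, Commute x y → Commute (c i x) (c i y) := by
    intro i x y h
    exact (Commute.conj_iff (f ^ i)).2 h
  have hc_comm' : ∀ i x y, Commute (c i x) (c i y) → Commute x y := by
    intro i x y h
    exact (Commute.conj_iff (f ^ i)).1 h
  have hc_mul : ∀ i x y, c i (x * y) = c i x * c i y := by
    intro i x y; simp only [c]; group
  have hc_succ : ∀ i x, f * c i x * f⁻¹ = c (i + 1) x := by
    intro i x; simp only [c, pow_succ']; group
  have hcD : ∀ i, ∀ x ∈ D, c i x ∈ D := by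
    intro i x hx
    induction i with
    | zero => simpa [c] using hx
    | succ i ih => rw [← hc_succ]; exact hfD _ ih
  let Z : Subgroup H := D ⊓ Subgroup.centralizer (D : Set H)
  have hZn : Nat.card Z ≤ n := by
    apply hn Z inf_le_left
    · intro a ha b hb
      exact ((Subgroup.mem_centralizer_iff.1 hb.2) a ha.1)
    · intro b hb
      refine ⟨hfD _ hb.1, ?_⟩
      change _ ∈ Subgroup.centralizer (D : Set H)
      rw [Subgroup.mem_centralizer_iff]
      intro d hd
      have h1 : c (p - 1) d ∈ D := hcD _ _ hd
      have h2 : Commute (c (p - 1) d) b := (Subgroup.mem_centralizer_iff.1 hb.2) _ h1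
      have h3 := hc_comm 1 _ _ h2
      rw [hc_add, show 1 + (p - 1) = 0 + p by omega, hc_p] at h3
      simpa [c] using h3.eq
  have hcomm : ∀ x ∈ D, ∀ y ∈ D, ⁅x, y⁆ ∈ Z := fun x hx y hy =>
    ⟨D.mul_mem (D.mul_mem (D.mul_mem hx hy) (D.inv_mem hx)) (D.inv_mem hy), hD (Subgroup.commutator_mem_commutator hx hy)⟩
  have hn1 : 0 < n := lt_of_lt_of_le Nat.card_pos hZn
  have hcent : ∀ x ∈ D, (Subgroup.centralizer {x}).relIndex D ≤ n := by
    intro x hx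
    refine (aux_relIndex_le _ _ (fun d : D => (⟨⁅(d : H), x⁆, hcomm _ d.2 _ hx⟩ : Z)) ?_).trans hZn
    rintro ⟨a, ha⟩ ⟨b, hb⟩ h
    have h1 : a * x * a⁻¹ * x⁻¹ = b * x * b⁻¹ * x⁻¹ := congrArg Subtype.val h
    rw [mul_left_inj] at h1
    rw [Subgroup.mem_centralizer_singleton_iff]
    calc a⁻¹ * b * x = a⁻¹ * (b * x * b⁻¹) * b := by group
      _ = _ := by rw [← h1]; group
  obtain ⟨B, hB⟩ := Set.Finite.exists_maximal (s := {B : Subgroup H | B ≤ D ∧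
      (∀ a ∈ B, ∀ b ∈ B, Commute a b) ∧ (∀ b ∈ B, f * b * f⁻¹ ∈ B)}) (Set.toFinite _)
      ⟨⊥, bot_le, by simp, by simp⟩
  obtain ⟨⟨hBD, hBab, hBf⟩, hBmax⟩ := hB
  have hBn := hn B hBD hBab hBf
  have key : ∀ m ≤ n ^ p, ∃ y : ℕ → H, (∀ j ≤ m, y j ∈ D) ∧ ∀ j k, j < k → k ≤ m →
      (∀ b ∈ B, Commute ((y j)⁻¹ * y k) b) ∧ (∀ i < p, Commute ((y j)⁻¹ * y k) (c i (y j))) ∧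
      (y j)⁻¹ * y k ∉ B := by
    intro m
    induction m with
    | zero =>
      intro _
      exact ⟨fun _ => 1, fun _ _ => D.one_mem, fun j k h1 h2 => by omega⟩
    | succ m ih =>
      intro hm
      obtain ⟨y, hyD, hy⟩ := ih (by omega)
      let SB : Finset H := (Set.toFinite (B : Set H)).toFinset
      have hSB : SB.card ≤ n := by
        rw [← Set.ncard_eq_toFinset_card]; exact hBn
      let S : Finset H := SB ∪
        (Finset.range (m + 1) ×ˢ Finset.range p).image (fun q => c q.2 (y q.1))
      have hSc : S.card ≤ n + (n ^ p + 1) * p := by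
        refine (Finset.card_union_le _ _).trans (add_le_add hSB (Finset.card_image_le.trans ?_))
        rw [Finset.card_product, Finset.card_range, Finset.card_range]
        gcongr; omega
      have hSD : ∀ x ∈ S, x ∈ D := by
        intro x hx
        rw [Finset.mem_union] at hx
        rcases hx with hx | hx
        · exact hBD (by simpa [SB] using hx)
        · obtain ⟨⟨j, i⟩, hq, rfl⟩ := Finset.mem_image.1 hx
          simp only [Finset.mem_product, Finset.mem_range] at hq
          exact hcD _ _ (hyD _ (by omega))
      let C : Subgroup H := ⨅ x : S, Subgroup.centralizer {(x : H)}
      have hCi : C.relIndex D ≤ n ^ (n + (n ^ p + 1) * p) := by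
        refine (Subgroup.relIndex_iInf_le _).trans ?_
        refine (Finset.prod_le_pow_card _ _ n (fun x _ => hcent _ (hSD _ x.2))).trans ?_
        refine Nat.pow_le_pow_right hn1 ?_
        simpa using hSc
      have hCcard : (n ^ p + 1) * n < Nat.card (C ⊓ D : Subgroup H) := by
        by_contra hlt
        rw [not_lt] at hlt
        have := aux_card_relIndex C D
        have h2 : Nat.card D ≤ auxN2 n p := by
          rw [this]; unfold auxN2; gcongr
        omega
      let X : Finset H := (Finset.range (m + 1) ×ˢ SB).image
        (fun q => ((y q.1)⁻¹ * y m)⁻¹ * q.2)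
      have hX : X.card ≤ (n ^ p + 1) * n := by
        refine Finset.card_image_le.trans ?_
        rw [Finset.card_product, Finset.card_range]
        gcongr; omega
      obtain ⟨x, hxC, hxX⟩ : ∃ x ∈ C ⊓ D, x ∉ X := by
        by_contra hno
        push Not at hno
        have : Nat.card (C ⊓ D : Subgroup H) ≤ X.card := by
          rw [← Set.ncard_coe_finset]
          exact Set.ncard_le_ncard (s := ((C ⊓ D : Subgroup H) : Set H)) hno (Set.toFinite _)
        omega
      have hxS : ∀ w ∈ S, Commute x w := by
        intro w hw
        have := (Subgroup.mem_iInf.1 hxC.1) ⟨w, hw⟩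
        rw [Subgroup.mem_centralizer_singleton_iff] at this
        exact this
      refine ⟨fun j => if j ≤ m then y j else y m * x, ?_, ?_⟩
      · intro j hj
        by_cases h : j ≤ m
        · simpa [h] using hyD j h
        · simpa [h] using D.mul_mem (hyD m le_rfl) hxC.2
      · intro j k hjk hk
        have hjm : j ≤ m := by omega
        by_cases h : k ≤ m
        · simpa [h, hjm] using hy j k hjk h
        · simp only [hjm, h, if_true, if_false]
          have hprev : (∀ b ∈ B, Commute ((y j)⁻¹ * y m) b) ∧
              (∀ i < p, Commute ((y j)⁻¹ * y m) (c i (y j))) := by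
            rcases hjm.lt_or_eq with h' | h'
            · exact ⟨(hy j m h' le_rfl).1, (hy j m h' le_rfl).2.1⟩
            · subst h'; simp
          rw [← mul_assoc]
          refine ⟨fun b hb => (hprev.1 b hb).mul_left (hxS _ ?_),
            fun i hi => (hprev.2 i hi).mul_left (hxS _ ?_), ?_⟩
          · exact Finset.mem_union_left _ (by simpa [SB] using hb)
          · refine Finset.mem_union_right _ (Finset.mem_image.2 ⟨(j, i), ?_, rfl⟩)
            simp only [Finset.mem_product, Finset.mem_range]; omega
          · intro hb
            apply hxX
            refine Finset.mem_image.2 ⟨(j, (y j)⁻¹ * y m * x), ?_, ?_⟩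
            · simp only [Finset.mem_product, Finset.mem_range]
              exact ⟨by omega, by simpa [SB] using hb⟩
            · change ((y j)⁻¹ * y m)⁻¹ * ((y j)⁻¹ * y m * x) = x
              group
  obtain ⟨y, hyD, hy⟩ := key (n ^ p) le_rfl
  let g : Fin (n ^ p + 1) → (Fin p → Z) := fun j i =>
    ⟨⁅y j, c i (y j)⁆, hcomm _ (hyD _ (by omega)) _ (hcD _ _ (hyD _ (by omega)))⟩
  have := Fintype.ofFinite Z
  obtain ⟨j, k, hjk, hg⟩ : ∃ j k, j < k ∧ g j = g k := by
    obtain ⟨j, k, hne, h⟩ := Fintype.exists_ne_map_eq_of_card_lt g (by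
      rw [Fintype.card_fun, Fintype.card_fin, Fintype.card_fin, ← Nat.card_eq_fintype_card]
      exact Nat.lt_succ_of_le (Nat.pow_le_pow_left hZn p))
    rcases lt_or_gt_of_ne hne with h' | h'
    · exact ⟨j, k, h', h⟩
    · exact ⟨k, j, h', h.symm⟩
  obtain ⟨hz1, hz2, hz3⟩ := hy j k hjk (by omega)
  obtain ⟨z, hz⟩ : ∃ z, z = (y j)⁻¹ * y k := ⟨_, rfl⟩
  rw [← hz] at hz1 hz2 hz3
  have hzD : z ∈ D := by
    rw [hz]; exact D.mul_mem (D.inv_mem (hyD _ (by omega))) (hyD _ (by omega))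
  have hyk : y k = y j * z := by rw [hz]; group
  have hzz : ∀ i < p, Commute z (c i z) := by
    intro i hi
    have h1 : ⁅y j, c i (y j)⁆ = ⁅y k, c i (y k)⁆ :=
      congrArg Subtype.val (congrFun hg ⟨i, hi⟩)
    rw [hyk, hc_mul] at h1
    have h2 : Commute z (c i (y j)) := hz2 i hi
    have h3 : Commute (y j) (c i z) := by
      rcases Nat.eq_zero_or_pos i with h0 | h0
      · subst h0
        have := hz2 0 hp
        simpa [c] using this.symm
      · have := hc_comm i _ _ (hz2 (p - i) (by omega))
        rw [hc_add, show i + (p - i) = 0 + p by omega, hc_p] at this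
        simpa [c] using this.symm
    generalize c i (y j) = a' at *
    generalize c i z = z' at *
    generalize y j = a at *
    have e1 : a * z * (a' * z') = a * a' * (z * z') := by
      calc a * z * (a' * z') = a * (z * a') * z' := by group
        _ = _ := by rw [h2.eq]; group
    have e2 : a' * z' * (a * z) = a' * a * (z' * z) := by
      calc a' * z' * (a * z) = a' * (z' * a) * z := by group
        _ = _ := by rw [← h3.eq]; group
    have e3 : a * z * (a' * z') = ⁅a, a'⁆ * (a' * z' * (a * z)) := by
      rw [h1, commutatorElement_def]; group
    have e4 : a * a' = ⁅a, a'⁆ * (a' * a) := by rw [commutatorElement_def]; group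
    rw [e1, e2, ← mul_assoc ⁅a, a'⁆, ← e4] at e3
    exact mul_left_cancel e3
  have hzz' : ∀ i, Commute z (c i z) := by
    intro i
    have : ∀ q, c (i % p + p * q) z = c (i % p) z := by
      intro q
      induction q with
      | zero => rfl
      | succ q ih => rw [mul_add, mul_one, ← add_assoc, hc_p, ih]
    rw [← Nat.mod_add_div i p, this]
    exact hzz _ (Nat.mod_lt _ hp)
  have hzzz : ∀ i k, i ≤ k → Commute (c i z) (c k z) := by
    intro i k hik
    have := hc_comm i _ _ (hzz' (k - i))
    rwa [hc_add, show i + (k - i) = k by omega] at this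
  have hzB : ∀ i, ∀ b ∈ B, Commute (c i z) b := by
    have hBi : ∀ i, ∀ b ∈ B, c i b ∈ B := by
      intro i b hb
      induction i with
      | zero => simpa [c] using hb
      | succ i ih => rw [← hc_succ]; exact hBf _ ih
    intro i b hb
    have h1 := hz1 (c (p * i - i) b) (hBi _ _ hb)
    have h2 := hc_comm i _ _ h1
    have : i ≤ p * i := Nat.le_mul_of_pos_left i hp
    rw [hc_add, show i + (p * i - i) = p * i by omega] at h2
    simpa [c, pow_mul, hfp] using h2
  let G : Set H := (B : Set H) ∪ Set.range (fun i => c i z)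
  have hGc : ∀ a ∈ G, ∀ b ∈ G, Commute a b := by
    rintro a (ha | ⟨i, rfl⟩) b (hb | ⟨k, rfl⟩)
    · exact hBab a ha b hb
    · exact (hzB k a ha).symm
    · exact hzB i b hb
    · rcases le_total i k with h | h
      · exact hzzz i k h
      · exact (hzzz k i h).symm
  have hB' : B ≤ Subgroup.closure G := fun b hb => Subgroup.subset_closure (Or.inl hb)
  have hmem : Subgroup.closure G ∈ {B : Subgroup H | B ≤ D ∧
      (∀ a ∈ B, ∀ b ∈ B, Commute a b) ∧ (∀ b ∈ B, f * b * f⁻¹ ∈ B)} := by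
    refine ⟨?_, ?_, ?_⟩
    · rw [Subgroup.closure_le]
      rintro a (ha | ⟨i, rfl⟩)
      · exact hBD ha
      · exact hcD _ _ hzD
    · intro a ha b hb
      induction ha, hb using Subgroup.closure_induction₂ with
      | mem x y hx hy => exact hGc x hx y hy
      | one_left x _ => exact Commute.one_left _
      | one_right x _ => exact Commute.one_right _
      | mul_left x y z _ _ _ h1 h2 => exact h1.mul_left h2
      | mul_right x y z _ _ _ h1 h2 => exact h1.mul_right h2
      | inv_left x y _ _ h => exact h.inv_left
      | inv_right x y _ _ h => exact h.inv_right
    · intro b hb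
      have : (Subgroup.closure G).map (MulAut.conj f).toMonoidHom ≤ Subgroup.closure G := by
        rw [MonoidHom.map_closure, Subgroup.closure_le]
        rintro _ ⟨a, ha | ⟨i, rfl⟩, rfl⟩
        · exact hB' (hBf a ha)
        · exact Subgroup.subset_closure (Or.inr ⟨i + 1, (hc_succ i z).symm⟩)
      exact this ⟨b, hb, rfl⟩
  have := hBmax hmem hB'
  apply hz3
  apply this
  exact Subgroup.subset_closure (Or.inr ⟨0, by simp [c]⟩)

theorem aux_hall {K L : Type*} [Group K] [Group L] [Finite K] (θ : K →* L)
    (hθ : Function.Surjective θ) (N : Subgroup K) [N.Normal] [Group.IsNilpotent N]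
    (hker : θ.ker ≤ ⁅N, N⁆) [Group.IsNilpotent L] : Group.IsNilpotent K := by
  have : Finite L := Finite.of_surjective θ hθ
  refine ((Group.isNilpotent_of_finite_tfae (G := K)).out 0 2).2 ?_
  have hL := ((Group.isNilpotent_of_finite_tfae (G := L)).out 0 2).1 ‹_›
  have hN := ((Group.isNilpotent_of_finite_tfae (G := N)).out 0 2).1 ‹_›
  intro M hM
  have hkM : θ.ker ≤ M := by
    by_contra hcon
    have hcon' : ¬ ⁅N, N⁆ ≤ M := fun h => hcon (hker.trans h)
    have htop : M ⊔ ⁅N, N⁆ = ⊤ := by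
      rcases hM.le_iff.1 (le_sup_left : M ≤ M ⊔ ⁅N, N⁆) with h | h
      · exact h
      · exact absurd (le_sup_right.trans h.le) hcon'
    have hNN : ⁅N, N⁆ ≤ N := Subgroup.commutator_le_left N N
    set R : Subgroup N := M.subgroupOf N with hR
    have hRtop : R ≠ ⊤ := by
      intro h
      rw [hR, Subgroup.subgroupOf_eq_top] at h
      exact hcon' (hNN.trans h)
    obtain h | ⟨S, hS, hRS⟩ := IsCoatomic.eq_top_or_exists_le_coatom R
    · exact hRtop h
    have hSn : S.Normal := hN S hS
    have hcyc : commutator N ≤ S := by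
      have hs : IsSimpleGroup (N ⧸ S) := by
        have : Nontrivial (N ⧸ S) := by
          rw [QuotientGroup.nontrivial_iff]; exact hS.1
        refine ⟨fun T hT => ?_⟩
        rcases hS.le_iff.1 (QuotientGroup.le_comap_mk' S T) with h | h
        · right
          rw [← Subgroup.map_comap_eq_self_of_surjective (QuotientGroup.mk'_surjective S) T, h]
          exact Subgroup.map_top_of_surjective _ (QuotientGroup.mk'_surjective S)
        · left
          rw [← Subgroup.map_comap_eq_self_of_surjective (QuotientGroup.mk'_surjective S) T, h]
          exact QuotientGroup.map_mk'_self S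
      have hnil : Group.IsNilpotent (N ⧸ S) := inferInstance
      have hsolv : Group.IsSolvable (N ⧸ S) := inferInstance
      have hc : ∀ a b : N ⧸ S, a * b = b * a := IsSimpleGroup.comm_iff_isSolvable.2 hsolv
      rw [commutator_def, Subgroup.commutator_le]
      intro a _ b _
      rw [← QuotientGroup.eq_one_iff]
      rw [← QuotientGroup.mk'_apply, map_commutatorElement, commutatorElement_eq_one_iff_mul_comm]
      exact hc _ _
    apply hS.1
    rw [eq_top_iff]
    rintro ⟨x, hx⟩ -
    have hxt : x ∈ M ⊔ ⁅N, N⁆ := htop ▸ Subgroup.mem_top x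
    rw [Subgroup.mem_sup_of_normal_right] at hxt
    obtain ⟨m, hm, n, hn, rfl⟩ := hxt
    have hmN : m ∈ N := by simpa using N.mul_mem hx (N.inv_mem (hNN hn))
    have h1 : (⟨m, hmN⟩ : N) ∈ S := hRS (by rw [hR, Subgroup.mem_subgroupOf]; exact hm)
    have h2 : (⟨n, hNN hn⟩ : N) ∈ S := by
      have hn' := hn
      apply hcyc
      rw [← Subgroup.map_subtype_commutator] at hn
      obtain ⟨y, hy, hyn⟩ := hn
      have : (⟨n, hNN hn'⟩ : N) = y := Subtype.ext hyn.symm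
      rw [this]; exact hy
    exact S.mul_mem h1 h2
  have hMM : (M.map θ).comap θ = M := by
    rw [Subgroup.comap_map_eq, sup_eq_left.2 hkM]
  have hco : IsCoatom (M.map θ) := by
    refine ⟨fun h => hM.1 ?_, fun T hT => ?_⟩
    · rw [← hMM, h, Subgroup.comap_top]
    · have h1 : M ≤ T.comap θ := Subgroup.map_le_iff_le_comap.1 hT.le
      rcases hM.le_iff.1 h1 with h | h
      · rw [← Subgroup.map_comap_eq_self_of_surjective hθ T, h]
        exact Subgroup.map_top_of_surjective _ hθ
      · rw [← Subgroup.map_comap_eq_self_of_surjective hθ T, h] at hT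
        exact absurd hT (lt_irrefl _)
  have := hL _ hco
  rw [← hMM]
  infer_instance

theorem aux_solv_lt {H : Type*} [Group H] (Q : Subgroup H) [Group.IsSolvable Q] (L : Subgroup H)
    (hL : L ≤ Q) (hL0 : L ≠ ⊥) : ⁅L, L⁆ < L := by
  have : Group.IsSolvable L :=
    Group.isSolvable_of_isSolvable_injective (Subgroup.inclusion_injective hL)
  have : Nontrivial L := (Subgroup.nontrivial_iff_ne_bot L).2 hL0
  have h := Group.IsSolvable.commutator_lt_top_of_nontrivial L
  refine lt_of_le_of_ne (Subgroup.commutator_le_self L) ?_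
  intro he
  rw [← Subgroup.map_subtype_commutator] at he
  apply h.ne
  apply Subgroup.map_injective L.subtype_injective
  rw [he, ← MonoidHom.range_eq_map, Subgroup.range_subtype]

open scoped commutatorElement in
theorem aux_exists_D {H : Type*} [Group H] [Finite H] (Q : Subgroup H) [Q.Normal]
    [Group.IsSolvable Q] : ∃ D : Subgroup H, D.Normal ∧ D ≤ Q ∧
      ⁅D, D⁆ ≤ Subgroup.centralizer (D : Set H) ∧
      Q ⊓ Subgroup.centralizer (D : Set H) ≤ D := by
  obtain ⟨A, ⟨hAn, hAQ, hAA⟩, hAmax⟩ := Set.Finite.exists_maximal (s := {A : Subgroup H |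
      A.Normal ∧ A ≤ Q ∧ A ≤ Subgroup.centralizer (A : Set H)}) (Set.toFinite _)
      ⟨⊥, inferInstance, bot_le, bot_le⟩
  obtain ⟨D, ⟨hDn, hAD, hDQ, hDA, hDD⟩, hDmax⟩ := Set.Finite.exists_maximal (s := {D : Subgroup H |
      D.Normal ∧ A ≤ D ∧ D ≤ Q ∧ D ≤ Subgroup.centralizer (A : Set H) ∧ ⁅D, D⁆ ≤ A}) (Set.toFinite _)
      ⟨A, hAn, le_rfl, hAQ, hAA, Subgroup.commutator_le_self A⟩
  have hAcD : A ≤ Subgroup.centralizer (D : Set H) := by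
    rwa [Subgroup.le_centralizer_iff]
  refine ⟨D, hDn, hDQ, hDD.trans hAcD, ?_⟩
  set K := Q ⊓ Subgroup.centralizer (D : Set H) with hK
  have hKn : K.Normal := by rw [hK]; infer_instance
  have hKD : K ⊓ D ≤ A := by
    apply hAmax
    · refine ⟨inferInstance, inf_le_right.trans hDQ, ?_⟩
      exact (inf_le_left.trans inf_le_right).trans (Subgroup.centralizer_le inf_le_right)
    · exact le_inf (le_inf hAQ hAcD) hAD
  suffices h : K ≤ A from h.trans hAD
  by_contra hcon
  obtain ⟨L, ⟨hLn, hLK, hLA⟩, hLmin⟩ := Set.Finite.exists_minimal (s := {L : Subgroup H |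
      L.Normal ∧ L ≤ K ∧ ¬ L ≤ A}) (Set.toFinite _) ⟨K, hKn, le_rfl, hcon⟩
  have hlt : ⁅L, L⁆ < L := aux_solv_lt Q L (hLK.trans inf_le_left) (by
    rintro rfl; exact hLA bot_le)
  have hLLA : ⁅L, L⁆ ≤ A := by
    by_contra h
    have := hLmin (y := ⁅L, L⁆) ⟨inferInstance, hlt.le.trans hLK, h⟩ hlt.le
    exact absurd (lt_of_lt_of_le hlt this) (lt_irrefl _)
  have hcomm : ∀ l ∈ L, ∀ d ∈ D, Commute d l := fun l hl d hd =>
    Subgroup.mem_centralizer_iff.1 (hLK hl).2 d hd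
  have hmem : D ⊔ L ≤ D := by
    apply hDmax
    · refine ⟨inferInstance, hAD.trans le_sup_left, sup_le hDQ (hLK.trans inf_le_left),
        sup_le hDA ((hLK.trans inf_le_right).trans (Subgroup.centralizer_le hAD)), ?_⟩
      rw [Subgroup.commutator_le]
      intro x hx y hy
      rw [Subgroup.mem_sup_of_normal_right] at hx hy
      obtain ⟨d, hd, l, hl, rfl⟩ := hx
      obtain ⟨d', hd', l', hl', rfl⟩ := hy
      have h1 : d * l * (d' * l') = d * d' * (l * l') := by
        calc _ = d * (l * d') * l' := by group
          _ = _ := by rw [← (hcomm l hl d' hd').eq]; group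
      have h2 : d' * l' * (d * l) = d' * d * (l' * l) := by
        calc _ = d' * (l' * d) * l := by group
          _ = _ := by rw [← (hcomm l' hl' d hd).eq]; group
      have h3 := (hcomm (l * l' * (l' * l)⁻¹) (L.mul_mem (L.mul_mem hl hl')
        (L.inv_mem (L.mul_mem hl' hl))) (d' * d)⁻¹ (D.inv_mem (D.mul_mem hd' hd))).eq
      have h4 : ⁅d * l, d' * l'⁆ = ⁅d, d'⁆ * ⁅l, l'⁆ := by
        calc _ = (d * l * (d' * l')) * (d' * l' * (d * l))⁻¹ := by
              rw [commutatorElement_def]; group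
          _ = d * d' * ((l * l' * (l' * l)⁻¹) * (d' * d)⁻¹) := by rw [h1, h2]; group
          _ = _ := by rw [← h3, commutatorElement_def, commutatorElement_def]; group
      rw [h4]
      exact A.mul_mem (hDD (Subgroup.commutator_mem_commutator hd hd'))
        (hLLA (Subgroup.commutator_mem_commutator hl hl'))
    · exact le_sup_left
  exact hLA ((le_inf hLK (le_sup_right.trans hmem)).trans hKD)

theorem aux_card_of_D {H : Type*} [Group H] [Finite H] (Q D : Subgroup H) [D.Normal]
    (h : Q ⊓ Subgroup.centralizer (D : Set H) ≤ D) :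
    Nat.card Q ≤ Nat.card D * (Nat.card D).factorial := by
  rw [aux_card_relIndex (Subgroup.centralizer (D : Set H)) Q, inf_comm]
  refine Nat.mul_le_mul (Subgroup.card_le_of_le h) ?_
  rw [← Nat.card_perm]
  refine aux_relIndex_le _ _ (fun q => (MulAut.conjNormal (q : H) : MulAut D).toEquiv) ?_
  intro a b hab
  rw [Subgroup.mem_centralizer_iff]
  intro d hd
  have h1 := congrArg (fun e : Equiv.Perm D => ((e ⟨d, hd⟩ : D) : H)) hab
  have h2 : (a : H) * d * (a : H)⁻¹ = b * d * (b : H)⁻¹ := by simpa using h1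
  symm
  calc (a : H)⁻¹ * b * d = (a : H)⁻¹ * (b * d * (b : H)⁻¹) * b := by group
    _ = _ := by rw [← h2]; group

theorem aux_Vr {H : Type*} [Group H] [Finite H] (V : Subgroup H) [hVn : V.Normal]
    (hV : ∀ a ∈ V, ∀ b ∈ V, Commute a b) (r : ℕ) (hr : r.Prime) :
    ∃ W : Subgroup H, W ≤ V ∧ W.Normal ∧ r.Coprime (Nat.card W) ∧
      ∃ k, ∀ v ∈ V, v ^ (r ^ k) ∈ W := by
  set k := (Nat.card V).factorization r with hk
  let W : Subgroup H :=
    { carrier := {w | ∃ v ∈ V, v ^ (r ^ k) = w}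
      one_mem' := ⟨1, V.one_mem, one_pow _⟩
      mul_mem' := by
        rintro _ _ ⟨a, ha, rfl⟩ ⟨b, hb, rfl⟩
        exact ⟨a * b, V.mul_mem ha hb, (hV a ha b hb).mul_pow _⟩
      inv_mem' := by
        rintro _ ⟨a, ha, rfl⟩
        exact ⟨a⁻¹, V.inv_mem ha, inv_pow _ _⟩ }
  refine ⟨W, ?_, ⟨?_⟩, ?_, k, fun v hv => ⟨v, hv, rfl⟩⟩
  · rintro _ ⟨a, ha, rfl⟩
    exact V.pow_mem ha _
  · rintro _ ⟨a, ha, rfl⟩ g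
    exact ⟨g * a * g⁻¹, hVn.conj_mem a ha g, conj_pow⟩
  · rw [hr.coprime_iff_not_dvd]
    intro hd
    have := Fact.mk hr
    obtain ⟨⟨w, hw⟩, hord⟩ := exists_prime_orderOf_dvd_card' r hd
    rw [Subgroup.orderOf_mk] at hord
    obtain ⟨v, hv, rfl⟩ := hw
    have h1 : v ^ (r ^ (k + 1)) = 1 := by
      rw [pow_succ, pow_mul]
      exact orderOf_dvd_iff_pow_eq_one.1 (dvd_of_eq hord)
    have h2 : orderOf v ∣ Nat.card V := by
      have := orderOf_dvd_natCard (⟨v, hv⟩ : V)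
      rwa [Subgroup.orderOf_mk] at this
    have h3 : orderOf v ∣ r ^ (k + 1) := orderOf_dvd_of_pow_eq_one h1
    obtain ⟨j, hj, hjo⟩ := (Nat.dvd_prime_pow hr).1 h3
    rw [hjo] at h2
    have h4 : j ≤ k := (hr.pow_dvd_iff_le_factorization Nat.card_pos.ne').1 h2
    have h5 : v ^ (r ^ k) = 1 := by
      rw [← orderOf_dvd_iff_pow_eq_one, hjo]
      exact pow_dvd_pow _ h4
    rw [h5, orderOf_one] at hord
    exact hr.one_lt.ne hord

theorem aux_Xnil {H : Type*} [Group H] [Finite H] (X W : Subgroup H) [W.Normal]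
    (hc : X ≤ Subgroup.centralizer (W : Set H)) (r : ℕ) [Fact r.Prime]
    (hX : ∀ x ∈ X, ∃ k, x ^ (r ^ k) ∈ W) : Group.IsNilpotent X := by
  have hpg : IsPGroup r (X ⧸ W.subgroupOf X) := by
    intro q
    obtain ⟨x, rfl⟩ := QuotientGroup.mk_surjective q
    obtain ⟨k, hk⟩ := hX x x.2
    refine ⟨k, ?_⟩
    rw [← QuotientGroup.mk_pow, QuotientGroup.eq_one_iff, Subgroup.mem_subgroupOf]
    simpa using hk
  have : Group.IsNilpotent (X ⧸ W.subgroupOf X) := hpg.isNilpotent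
  refine Subgroup.isNilpotent_of_ker_le_center (QuotientGroup.mk' (W.subgroupOf X)) ?_
  rw [QuotientGroup.ker_mk']
  intro x hx
  rw [Subgroup.mem_center_iff]
  intro g
  exact Subtype.ext (Subgroup.mem_centralizer_iff.1 (hc g.2) x hx).symm

theorem aux_Dr {L : Type*} [Group L] [Finite L] (D : Subgroup L) [D.Normal]
    (hD : ⁅D, D⁆ ≤ Subgroup.centralizer (D : Set L)) (r : ℕ) [Fact r.Prime] :
    ∃ P : Subgroup L, P ≤ D ∧ P.Normal ∧ IsPGroup r P ∧
      ∀ R : Subgroup L, R ≤ D → IsPGroup r R → R ≤ P := by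
  have hnil : Group.IsNilpotent D := by
    refine Subgroup.isNilpotent_of_ker_le_center (Abelianization.of (G := D)) ?_
    rw [Abelianization.ker_of]
    intro x hx
    have hx' : (x : L) ∈ ⁅D, D⁆ := by
      rw [← Subgroup.map_subtype_commutator]; exact ⟨x, hx, rfl⟩
    rw [Subgroup.mem_center_iff]
    intro g
    exact Subtype.ext (Subgroup.mem_centralizer_iff.1 (hD hx') g g.2)
  have hsy := ((Group.isNilpotent_of_finite_tfae (G := D)).out 0 3).1 hnil
  obtain ⟨P⟩ : Nonempty (Sylow r D) := inferInstance
  have hPn : (P : Subgroup D).Normal := hsy r inferInstance P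
  have hPc : (P : Subgroup D).Characteristic := Sylow.characteristic_of_normal P hPn
  refine ⟨(P : Subgroup D).map D.subtype, Subgroup.map_subtype_le _, inferInstance,
    P.2.map _, ?_⟩
  intro R hR hRp
  have h1 : IsPGroup r (R.subgroupOf D) := hRp.comap_of_injective D.subtype D.subtype_injective
  obtain ⟨Q, hQ⟩ := h1.exists_le_sylow
  have : Subsingleton (Sylow r D) := by
    have := Sylow.unique_of_normal P hPn
    infer_instance
  rw [Subsingleton.elim Q P] at hQ
  intro x hx
  exact ⟨⟨x, hR hx⟩, hQ (by rw [Subgroup.mem_subgroupOf]; exact hx), rfl⟩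

theorem aux_M4 {H : Type*} [Group H] [Finite H] (V G W : Subgroup H) [V.Normal] [hGn : G.Normal]
    [W.Normal] (hVG : V ≤ G) (hWV : W ≤ V) (hV : ∀ a ∈ V, ∀ b ∈ V, Commute a b)
    (f : H) (p s : ℕ) (hp : p.Prime) (hfp : f ^ p = 1)
    (hs : Nat.card (G ⊓ Subgroup.centralizer {f} : Subgroup H) ≤ s)
    (B : Subgroup (H ⧸ V)) (hBG : B ≤ G.map (QuotientGroup.mk' V))
    (hBc : ∀ a ∈ B, ∀ b ∈ B, Commute a b)
    (hBf : ∀ b ∈ B, (f : H ⧸ V) * b * (f : H ⧸ V)⁻¹ ∈ B)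
    (hcop : (Nat.card B).Coprime (Nat.card W))
    (hfaith : ∀ h : H, (h : H ⧸ V) ∈ B → (∀ v ∈ W, Commute h v) → h ∈ V) :
    Nat.card B ≤ auxN0 p s := by
  let : CommGroup B := { (inferInstance : Group B) with
    mul_comm := fun a b => Subtype.ext (hBc a a.2 b b.2) }
  let : CommGroup W := { (inferInstance : Group W) with
    mul_comm := fun a b => Subtype.ext (hV a (hWV a.2) b (hWV b.2)) }
  let τ : H ⧸ V →* MulAut W := QuotientGroup.lift V MulAut.conjNormal (by
    intro v hv
    ext w
    rw [MulAut.conjNormal_apply, (hV v hv w (hWV w.2)).eq]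
    simp)
  have hτ : ∀ (h : H) (w : W), ((τ (h : H ⧸ V) w : W) : H) = h * w * h⁻¹ := by
    intro h w
    exact MulAut.conjNormal_apply h w
  let ρ : B →* AddMonoid.End (Additive W) :=
    { toFun := fun b => MonoidHom.toAdditive (τ b).toMonoidHom
      map_one' := by ext x; simp only [Subgroup.coe_one, map_one]; rfl
      map_mul' := by intro a b; ext x; simp only [Subgroup.coe_mul, map_mul]; rfl }
  have hρ : ∀ (b : B) (w : W), ρ b (Additive.ofMul w) = Additive.ofMul (τ b w) := fun _ _ => rfl
  let F : Additive W ≃+ Additive W := MulEquiv.toAdditive (MulAut.conjNormal f : MulAut W)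
  have hF : ∀ w : W, F (Additive.ofMul w) = Additive.ofMul (MulAut.conjNormal f w) := fun _ => rfl
  let e0 : B →* B :=
    { toFun := fun b => ⟨(f : H ⧸ V) * b * (f : H ⧸ V)⁻¹, hBf b b.2⟩
      map_one' := by ext; simp
      map_mul' := by intro a b; ext; simp }
  have he0 : Function.Injective e0 := by
    intro a b hab
    have := congrArg (fun x : B => (x : H ⧸ V)) hab
    exact Subtype.ext (by simpa [e0] using this)
  let e : B ≃* B := MulEquiv.ofBijective e0 (Finite.injective_iff_bijective.1 he0)
  have he : ∀ b : B, ((e b : B) : H ⧸ V) = f * b * (f : H ⧸ V)⁻¹ := fun _ => rfl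
  refine aux_module ρ ?_ F e p hp ?_ ?_ ?_ hcop s ?_ ?_
  · rw [injective_iff_map_eq_one]
    rintro ⟨b, hb⟩ h1
    obtain ⟨h, rfl⟩ := QuotientGroup.mk_surjective b
    have : h ∈ V := by
      apply hfaith h hb
      intro v hv
      have h2 : τ (h : H ⧸ V) ⟨v, hv⟩ = ⟨v, hv⟩ :=
        congrArg (fun g : AddMonoid.End (Additive W) => (g (Additive.ofMul ⟨v, hv⟩)).toMul) h1
      have h3 := hτ h ⟨v, hv⟩
      rw [h2] at h3
      exact (eq_mul_inv_iff_mul_eq.1 h3).symm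
    exact Subtype.ext ((QuotientGroup.eq_one_iff h).2 this)
  · rintro ⟨b, hb⟩ m
    obtain ⟨h, rfl⟩ := QuotientGroup.mk_surjective b
    obtain ⟨w, rfl⟩ := Additive.ofMul.surjective m
    rw [hρ, hF, hF, hρ]
    apply congrArg Additive.ofMul
    apply Subtype.ext
    have h1 := hτ (f * h * f⁻¹) (MulAut.conjNormal f w)
    rw [MulAut.conjNormal_apply, hτ, he]
    refine Eq.trans ?_ h1.symm
    rw [MulAut.conjNormal_apply]
    group
  · have h1 : ∀ i (w : W), F^[i] (Additive.ofMul w) = Additive.ofMul (MulAut.conjNormal (f ^ i) w) := by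
      intro i
      induction i with
      | zero => intro w; simp
      | succ i ih =>
        intro w
        rw [Function.iterate_succ_apply', ih, hF, pow_succ', map_mul]; rfl
    intro m
    obtain ⟨w, rfl⟩ := Additive.ofMul.surjective m
    rw [h1, hfp]; simp
  · have h1 : ∀ i (b : B), ((e^[i] b : B) : H ⧸ V) = (f : H ⧸ V) ^ i * b * ((f : H ⧸ V) ^ i)⁻¹ := by
      intro i
      induction i with
      | zero => intro b; simp
      | succ i ih =>
        intro b
        rw [Function.iterate_succ_apply', he, ih, pow_succ']; group
    intro b
    apply Subtype.ext
    rw [h1, ← QuotientGroup.mk_pow, hfp]; simp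
  · refine le_trans ?_ hs
    refine Nat.card_le_card_of_injective
      (fun m : {m : Additive W // F m = m} =>
        (⟨((m.1.toMul : W) : H), hVG (hWV m.1.toMul.2), ?_⟩ :
          (G ⊓ Subgroup.centralizer {f} : Subgroup H))) ?_
    · change _ ∈ Subgroup.centralizer {f}
      rw [Subgroup.mem_centralizer_singleton_iff]
      have h1 : MulAut.conjNormal f m.1.toMul = m.1.toMul := m.2
      have h2 := MulAut.conjNormal_apply f m.1.toMul
      rw [h1] at h2
      exact eq_mul_inv_iff_mul_eq.1 h2
    · intro a b hab
      have h1 := congrArg (fun x : (G ⊓ Subgroup.centralizer {f} : Subgroup H) => (x : H)) hab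
      have h2 : a.1.toMul = b.1.toMul := Subtype.ext h1
      exact Subtype.ext h2
  · refine le_trans ?_ ((aux_fix_card_map (QuotientGroup.mk' V) G f
      (fun b hb => hGn.conj_mem b hb f)).trans hs)
    refine Nat.card_le_card_of_injective
      (fun m : {b : B // e b = b} =>
        (⟨m.1.1, hBG m.1.2, ?_⟩ : (G.map (QuotientGroup.mk' V) ⊓
          Subgroup.centralizer {QuotientGroup.mk' V f} : Subgroup (H ⧸ V)))) ?_
    · change _ ∈ Subgroup.centralizer {QuotientGroup.mk' V f}
      rw [Subgroup.mem_centralizer_singleton_iff]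
      have h2 := he m.1
      rw [m.2] at h2
      exact eq_mul_inv_iff_mul_eq.1 h2
    · intro a b hab
      have h1 := congrArg (fun x : (G.map (QuotientGroup.mk' V) ⊓
          Subgroup.centralizer {QuotientGroup.mk' V f} : Subgroup (H ⧸ V)) => (x : H ⧸ V)) hab
      exact Subtype.ext (Subtype.ext h1)

/-- The bound for the metabelian-by-class-two step. -/
def auxN3 (p s : ℕ) : ℕ :=
  auxN2 (auxN0 p s).factorial p * (auxN2 (auxN0 p s).factorial p).factorial

theorem aux_card_le_factorial {L : Type*} [Group L] [Finite L] (B : Subgroup L)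
    (hBc : ∀ a ∈ B, ∀ b ∈ B, Commute a b) (f : L) (hBf : ∀ b ∈ B, f * b * f⁻¹ ∈ B) (n : ℕ)
    (h : ∀ r : ℕ, r.Prime → ∀ R : Subgroup L, R ≤ B → IsPGroup r R →
      (∀ b ∈ R, f * b * f⁻¹ ∈ R) → Nat.card R ≤ n) : Nat.card B ≤ n.factorial := by
  refine Nat.le_of_dvd n.factorial_pos ?_
  rw [Nat.dvd_iff_prime_pow_dvd_dvd]
  intro r k hr hk
  have := Fact.mk hr
  let R : Subgroup L :=
    { carrier := {x | x ∈ B ∧ ∃ k, x ^ (r ^ k) = 1}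
      one_mem' := ⟨B.one_mem, 0, by simp⟩
      mul_mem' := by
        rintro a b ⟨ha, i, hi⟩ ⟨hb, j, hj⟩
        refine ⟨B.mul_mem ha hb, i + j, ?_⟩
        rw [(hBc a ha b hb).mul_pow, pow_add, pow_mul, hi, one_pow, mul_comm, pow_mul, hj, one_pow,
          one_mul]
      inv_mem' := by
        rintro a ⟨ha, i, hi⟩
        exact ⟨B.inv_mem ha, i, by rw [inv_pow, hi, inv_one]⟩ }
  have hR : Nat.card R ≤ n := by
    apply h r hr R
    · exact fun x hx => hx.1
    · rintro ⟨x, hx, k, hk⟩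
      exact ⟨k, Subtype.ext hk⟩
    · rintro x ⟨hx, k, hk⟩
      exact ⟨hBf x hx, k, by rw [conj_pow, hk]; simp⟩
  obtain ⟨P⟩ : Nonempty (Sylow r B) := inferInstance
  have hP : (P : Subgroup B).map B.subtype ≤ R := by
    rintro _ ⟨x, hx, rfl⟩
    obtain ⟨k, hk⟩ := P.2 ⟨x, hx⟩
    refine ⟨x.2, k, ?_⟩
    have := congrArg (fun y : (P : Subgroup B) => ((y : B) : L)) hk
    simpa using this
  have h1 := Subgroup.card_le_of_le hP
  rw [Subgroup.card_map_of_injective B.subtype_injective, P.card_eq_multiplicity] at h1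
  refine Nat.dvd_factorial (pow_pos hr.pos k) (le_trans ?_ (h1.trans hR))
  exact Nat.pow_le_pow_right hr.pos ((hr.pow_dvd_iff_le_factorization Nat.card_pos.ne').1 hk)

theorem aux_M {H : Type*} [Group H] [Finite H] (V G : Subgroup H) [V.Normal] [hGn : G.Normal]
    [Group.IsSolvable G] (hVG : V ≤ G) (hV : ∀ a ∈ V, ∀ b ∈ V, Commute a b)
    (f : H) (p s : ℕ) (hp : p.Prime) (hfp : f ^ p = 1)
    (hs : Nat.card (G ⊓ Subgroup.centralizer {f} : Subgroup H) ≤ s)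
    (hmax : ∀ X : Subgroup H, X.Normal → V ≤ X → X ≤ G → Group.IsNilpotent X → X ≤ V) :
    V.relIndex G ≤ auxN3 p s := by
  set π := QuotientGroup.mk' V with hπ
  have hsurj : Function.Surjective π := QuotientGroup.mk'_surjective V
  set Q := G.map π with hQ
  have hQn : Q.Normal := hGn.map π hsurj
  have hQs : Group.IsSolvable Q :=
    Group.isSolvable_of_surjective (π.subgroupMap_surjective G)
  obtain ⟨D, hDn, hDQ, hDD, hDc⟩ := aux_exists_D Q
  have hrel : V.relIndex G = Nat.card Q := by
    rw [hQ, ← Subgroup.relIndex_ker, hπ, QuotientGroup.ker_mk']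
  have hDcard : Nat.card D ≤ auxN2 (auxN0 p s).factorial p := by
    refine aux_class2 D (π f) (fun d hd => hDn.conj_mem d hd _) p hp.pos
      (by rw [← map_pow, hfp, map_one]) hDD _ ?_
    intro B hBD hBc hBf
    refine aux_card_le_factorial B hBc (π f) hBf _ ?_
    intro r hr R hRB hRp hRf
    have := Fact.mk hr
    obtain ⟨W, hWV, hWn, hWr, k, hk⟩ := aux_Vr V hV r hr
    obtain ⟨P, hPD, hPn, hPp, hPmax⟩ := aux_Dr D hDD r
    have hRP : R ≤ P := hPmax R (hRB.trans hBD) hRp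
    refine aux_M4 V G W hVG hWV hV f p s hp hfp hs R (hRB.trans (hBD.trans hDQ))
      (fun a ha b hb => hBc a (hRB ha) b (hRB hb)) hRf ?_ ?_
    · obtain ⟨m, hm⟩ := IsPGroup.iff_card.1 hRp
      rw [hm]
      exact hWr.pow_left m
    · intro h hh hhW
      set X : Subgroup H := P.comap π ⊓ Subgroup.centralizer (W : Set H) with hX
      have hXV : X ≤ V := by
        apply hmax
        · rw [hX]; infer_instance
        · refine le_inf ?_ ?_
          · intro v hv
            have : π v = 1 := (QuotientGroup.eq_one_iff v).2 hv
            rw [Subgroup.mem_comap, this]; exact P.one_mem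
          · intro v hv
            rw [Subgroup.mem_centralizer_iff]
            intro w hw
            exact hV w (hWV hw) v hv
        · refine inf_le_left.trans ?_
          have h1 : P.comap π ≤ Q.comap π := Subgroup.comap_mono (hPD.trans hDQ)
          refine h1.trans ?_
          rw [hQ, Subgroup.comap_map_eq, hπ, QuotientGroup.ker_mk', sup_eq_left.2 hVG]
        · refine aux_Xnil X W inf_le_right r ?_
          intro x hx
          obtain ⟨j, hj⟩ := hPp ⟨π x, hx.1⟩
          have h2 : π (x ^ (r ^ j)) = 1 := by
            rw [map_pow]
            exact congrArg (fun y : P => (y : H ⧸ V)) hj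
          have h3 : x ^ (r ^ j) ∈ V := (QuotientGroup.eq_one_iff _).1 h2
          refine ⟨j + k, ?_⟩
          rw [pow_add, pow_mul]
          exact hk _ h3
      apply hXV
      refine ⟨hRP hh, ?_⟩
      change h ∈ Subgroup.centralizer (W : Set H)
      rw [Subgroup.mem_centralizer_iff]
      intro w hw
      exact (hhW w hw).symm
  rw [hrel]
  refine (aux_card_of_D Q D hDc).trans ?_
  exact Nat.mul_le_mul hDcard (Nat.factorial_le hDcard)

open scoped commutatorElement in
theorem aux_main {H : Type*} [Group H] [Finite H] (G : Subgroup H) [hGn : G.Normal]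
    [Group.IsSolvable G] (f : H) (p s : ℕ) (hp : p.Prime) (hfp : f ^ p = 1)
    (hs : Nat.card (G ⊓ Subgroup.centralizer {f} : Subgroup H) ≤ s) :
    ∃ N : Subgroup H, N.Normal ∧ N ≤ G ∧ Group.IsNilpotent N ∧ N.relIndex G ≤ auxN3 p s := by
  obtain ⟨N, ⟨hNn, hNG, hNnil⟩, hNmax⟩ := Set.Finite.exists_maximal (s := {N : Subgroup H |
      N.Normal ∧ N ≤ G ∧ Group.IsNilpotent N}) (Set.toFinite _)
      ⟨⊥, inferInstance, bot_le, inferInstance⟩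
  refine ⟨N, hNn, hNG, hNnil, ?_⟩
  set π := QuotientGroup.mk' ⁅N, N⁆ with hπ
  have hsurj : Function.Surjective π := QuotientGroup.mk'_surjective _
  have hker : π.ker = ⁅N, N⁆ := QuotientGroup.ker_mk' _
  have hNN : ⁅N, N⁆ ≤ N := Subgroup.commutator_le_self N
  have hVn : (N.map π).Normal := hNn.map π hsurj
  have hGn' : (G.map π).Normal := hGn.map π hsurj
  have hQs : Group.IsSolvable (G.map π) :=
    Group.isSolvable_of_surjective (π.subgroupMap_surjective G)
  have hcN : (N.map π).comap π = N := by
    rw [Subgroup.comap_map_eq, hker, sup_eq_left.2 hNN]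
  have hcG : (G.map π).comap π = G := by
    rw [Subgroup.comap_map_eq, hker, sup_eq_left.2 (hNN.trans hNG)]
  have key := aux_M (N.map π) (G.map π) (Subgroup.map_mono hNG) ?_ (π f) p s hp
    (by rw [← map_pow, hfp, map_one])
    ((aux_fix_card_map π G f (fun b hb => hGn.conj_mem b hb f)).trans hs) ?_
  · have : N.relIndex G = (N.map π).relIndex (G.map π) := by
      rw [← Subgroup.relIndex_comap, hcN]
    rw [this]; exact key
  · rintro _ ⟨a, ha, rfl⟩ _ ⟨b, hb, rfl⟩
    rw [← commutatorElement_eq_one_iff_commute, ← map_commutatorElement, ← MonoidHom.mem_ker, hker]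
    exact Subgroup.commutator_mem_commutator ha hb
  · intro X hXn hVX hXG hXnil
    have hNX : N ≤ X.comap π := Subgroup.map_le_iff_le_comap.1 hVX
    have hnil : Group.IsNilpotent (X.comap π) := by
      have hn1 : Group.IsNilpotent (N.subgroupOf (X.comap π)) :=
        Group.nilpotent_of_mulEquiv (Subgroup.subgroupOfEquivOfLe hNX).symm
      refine aux_hall (π.subgroupComap X) (π.subgroupComap_surjective_of_surjective X hsurj)
        (N.subgroupOf (X.comap π)) ?_
      intro x hx
      have h1 : (x : H) ∈ ⁅N, N⁆ := by
        have h0 : π x = 1 := congrArg (fun y : X => (y : H ⧸ ⁅N, N⁆)) hx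
        exact (QuotientGroup.eq_one_iff _).1 h0
      have h2 : ⁅N.subgroupOf (X.comap π), N.subgroupOf (X.comap π)⁆.map (X.comap π).subtype
          = ⁅N, N⁆ := by
        rw [Subgroup.map_commutator, Subgroup.subgroupOf_map_subtype, inf_eq_left.2 hNX]
      obtain ⟨y, hy, hyx⟩ := h2.ge h1
      rw [← Subtype.ext hyx]; exact hy
    have := hNmax (y := X.comap π) ⟨inferInstance, by rw [← hcG]; exact Subgroup.comap_mono hXG,
      hnil⟩ hNX
    rw [← Subgroup.map_comap_eq_self_of_surjective hsurj X]
    exact Subgroup.map_mono this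

theorem stmt18 :
    ∃ f : ℕ → ℕ → ℕ, ∀ (G : Type) (_ : Group G) (_ : Finite G) (_ : IsSolvable G)
      (φ : G ≃* G) (p s : ℕ),
      p.Prime → orderOf φ = p → Nat.card {g : G | φ g = g} = s →
      ∃ N : Subgroup G, N.Normal ∧ Group.IsNilpotent ↥N ∧ N.index ≤ f p s := by
  refine ⟨auxN3, ?_⟩
  intro G _ _ hsol φ p s hp hord hs
  have hsol' : Group.IsSolvable G := hsol
  let Z : Subgroup (MulAut G) := Subgroup.zpowers φ
  have : Finite (MulAut G) := Finite.of_injective (fun e : MulAut G => (e : G → G)) DFunLike.coe_injective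
  let H := G ⋊[Z.subtype] Z
  have : Finite H := Finite.of_equiv _ SemidirectProduct.equivProd.symm
  let ι : G →* H := SemidirectProduct.inl
  have hι : Function.Injective ι := SemidirectProduct.inl_injective
  let z : Z := ⟨φ, Subgroup.mem_zpowers _⟩
  let f : H := SemidirectProduct.inr z
  have hfp : f ^ p = 1 := by
    have : z ^ p = 1 := Subtype.ext (by rw [← hord]; exact pow_orderOf_eq_one φ)
    rw [← map_pow, this, map_one]
  have hrn : ι.range.Normal := by
    rw [SemidirectProduct.range_inl_eq_ker_rightHom]; infer_instance
  have hsolr : Group.IsSolvable ι.range :=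
    Group.isSolvable_of_surjective ι.rangeRestrict_surjective
  have hconj : ∀ g, f * ι g * f⁻¹ = ι (φ g) := by
    intro g
    have h := SemidirectProduct.inl_aut (φ := Z.subtype) z g
    rw [map_inv] at h
    exact h.symm
  obtain ⟨N, hNn, hNG, hNnil, hNi⟩ := aux_main ι.range f p s hp hfp (by
    rw [← hs]
    have hg : ∀ x : (ι.range ⊓ Subgroup.centralizer {f} : Subgroup H), ∃ g : {g : G | φ g = g},
        ι g = x := by
      rintro ⟨_, ⟨g, rfl⟩, hx⟩
      refine ⟨⟨g, ?_⟩, rfl⟩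
      have h1 : ι g * f = f * ι g := Subgroup.mem_centralizer_singleton_iff.1 hx
      have h2 := hconj g
      rw [← h1, mul_inv_cancel_right] at h2
      exact (hι h2).symm
    choose g hg using hg
    refine Nat.card_le_card_of_injective g ?_
    intro a b hab
    apply Subtype.ext
    rw [← hg a, ← hg b, hab])
  refine ⟨N.comap ι, inferInstance, ?_, ?_⟩
  · have hinj : Function.Injective (ι.subgroupComap N) := by
      intro a b hab
      exact Subtype.ext (hι (congrArg (fun y : N => (y : H)) hab))
    refine Subgroup.isNilpotent_of_ker_le_center (ι.subgroupComap N) ?_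
    rw [(MonoidHom.ker_eq_bot_iff _).2 hinj]
    exact bot_le
  · rwa [Subgroup.index_comap]
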